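/- arXiv:math/0410449 — 2 statements merged into one kernel-verified Lean document; each statement's English description precedes it below -/
import Mathlib

section
/- Let H be a separable infinite-dimensional complex Hilbert space. There exists a compact injective operator K = [K_1 K_2 ⋯] from the Hilbert space direct sum H^(∞) = ⊕_{i≥1} H (the ℓ²-direct sum of countably many copies of H) into H such that the range of each component operator K_i = K∘ι_i (where ι_i is the isometric inclusion of the i-th summand) is dense in H. -/
noncomputable section

open Filter Topology in
theorem aux_inj (a : ℕ → ℂ) (ha : Summable fun m => ‖a m‖)
    (h : ∀ n : ℕ, ∑' m : ℕ, a m * ((1 / ((m : ℂ) + 2)) ^ n) = 0) : ∀ m, a m = 0 := by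
  intro m
  induction m using Nat.strong_induction_on with
  | _ m ih =>
  have h2 : ∀ k : ℕ, ((k : ℂ) + 2) ≠ 0 := by
    intro k
    exact_mod_cast (by positivity : ((k : ℝ) + 2) ≠ 0)
  have hn : ∀ k : ℕ, ‖((m : ℂ) + 2) / ((k : ℂ) + 2)‖ = ((m : ℝ) + 2) / ((k : ℝ) + 2) := by
    intro k
    have : ((m : ℂ) + 2) / ((k : ℂ) + 2) = (((((m : ℝ) + 2) / ((k : ℝ) + 2)) : ℝ) : ℂ) := by
      push_cast; rfl
    rw [this, Complex.norm_real, Real.norm_of_nonneg (by positivity)]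
  have key : Tendsto (fun n : ℕ => ∑' k : ℕ, a k * (((m : ℂ) + 2) / ((k : ℂ) + 2)) ^ n) atTop
      (𝓝 (∑' k : ℕ, if k = m then a m else 0)) := by
    refine tendsto_tsum_of_dominated_convergence ha ?_ ?_
    · intro k
      by_cases hk : k = m
      · subst hk
        simp [div_self (h2 k)]
      · rcases lt_or_gt_of_ne hk with hlt | hgt
        · simp [ih k hlt, hk]
        · simp only [hk, if_false]
          have := tendsto_pow_atTop_nhds_zero_of_norm_lt_one
            (x := ((m : ℂ) + 2) / ((k : ℂ) + 2)) (by
              rw [hn, div_lt_one (by positivity)]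
              have : (m : ℝ) < k := by exact_mod_cast hgt
              linarith)
          simpa using this.const_mul (a k)
    · refine Eventually.of_forall fun n k => ?_
      rcases lt_or_ge k m with hlt | hge
      · simp [ih k hlt]
      · rw [norm_mul, norm_pow, hn]
        refine mul_le_of_le_one_right (norm_nonneg _) (pow_le_one₀ (by positivity) ?_)
        rw [div_le_one (by positivity)]
        have : (m : ℝ) ≤ k := by exact_mod_cast hge
        linarith
  have hz : ∀ n : ℕ, ∑' k : ℕ, a k * (((m : ℂ) + 2) / ((k : ℂ) + 2)) ^ n = 0 := by
    intro n
    have : ∀ k : ℕ, a k * (((m : ℂ) + 2) / ((k : ℂ) + 2)) ^ n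
        = ((m : ℂ) + 2) ^ n * (a k * ((1 / ((k : ℂ) + 2)) ^ n)) := by
      intro k
      rw [div_pow, div_pow, one_pow]; ring
    simp_rw [this]
    rw [tsum_mul_left, h n, mul_zero]
  simp_rw [hz] at key
  rw [tsum_ite_eq] at key
  exact (tendsto_nhds_unique key tendsto_const_nhds)

open Filter Topology in
theorem aux_dense (c : ℕ → ℂ) (C : ℝ) (hc : ∀ n, ‖c n‖ ≤ C) (t : ℕ → ℂ)
    (ht : ∀ j, ‖t j‖ ≤ 1 / 2) (ht0 : ∀ j, t j ≠ 0) (htt : Tendsto t atTop (𝓝 0))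
    (h : ∀ j : ℕ, ∑' n : ℕ, c n * t j ^ n = 0) : ∀ n, c n = 0 := by
  intro N
  induction N using Nat.strong_induction_on with
  | _ N ih =>
  have hC : 0 ≤ C := (norm_nonneg _).trans (hc 0)
  have key : Tendsto (fun j : ℕ => ∑' n : ℕ, c n * t j ^ (n - N)) atTop
      (𝓝 (∑' n : ℕ, if n = N then c N else 0)) := by
    refine tendsto_tsum_of_dominated_convergence
      (bound := fun n => C * 2 ^ N * (1 / 2) ^ n) ?_ ?_ ?_
    · exact (summable_geometric_two).mul_left _
    · intro n
      by_cases hk : n = N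
      · subst hk; simp
      · rcases lt_or_gt_of_ne hk with hlt | hgt
        · simp [ih n hlt, hk]
        · simp only [hk, if_false]
          have := (htt.pow (n - N)).const_mul (c n)
          rwa [zero_pow (by omega), mul_zero] at this
    · refine Eventually.of_forall fun j n => ?_
      rcases lt_or_ge n N with hlt | hge
      · simp only [ih n hlt, zero_mul, norm_zero]; positivity
      · rw [norm_mul, norm_pow]
        obtain ⟨d, rfl⟩ := Nat.exists_eq_add_of_le hge
        have e : C * 2 ^ N * (1 / 2) ^ (N + d) = C * (1 / 2 : ℝ) ^ d := by
          rw [pow_add, div_pow, one_pow]; field_simp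
        rw [e, Nat.add_sub_cancel_left]
        exact mul_le_mul (hc _) (pow_le_pow_left₀ (norm_nonneg _) (ht j) d) (by positivity) hC
  have hz : ∀ j : ℕ, ∑' n : ℕ, c n * t j ^ (n - N) = 0 := by
    intro j
    have : ∀ n : ℕ, c n * t j ^ (n - N) = (t j ^ N)⁻¹ * (c n * t j ^ n) := by
      intro n
      rcases lt_or_ge n N with hlt | hge
      · simp [ih n hlt]
      · obtain ⟨d, rfl⟩ := Nat.exists_eq_add_of_le hge
        have := ht0 j
        rw [Nat.add_sub_cancel_left, pow_add]
        field_simp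
    simp_rw [this]
    rw [tsum_mul_left, h j, mul_zero]
  simp_rw [hz] at key
  rw [tsum_ite_eq] at key
  exact (tendsto_nhds_unique key tendsto_const_nhds)

theorem aux_basis
    (H : Type) [NormedAddCommGroup H] [InnerProductSpace ℂ H] [CompleteSpace H]
    [TopologicalSpace.SeparableSpace H] (hinf : ¬ FiniteDimensional ℂ H) :
    ∃ b : ℕ → H, Orthonormal ℂ b ∧ ∀ y, (∀ n, inner ℂ (b n) y = 0) → y = 0 := by
  obtain ⟨w, b, hb⟩ := exists_hilbertBasis ℂ H
  have ho := b.orthonormal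
  have hcount : Countable w := by
    refine Pairwise.countable_of_isOpen_disjoint (s := fun i : w => Metric.ball (b i) (1 / 2))
      ?_ (fun _ => Metric.isOpen_ball) (fun i => ⟨b i, Metric.mem_ball_self (by norm_num)⟩)
    intro i j hij
    refine Metric.ball_disjoint_ball ?_
    have h1 : ‖b i - b j‖ * ‖b i - b j‖ = 2 := by
      rw [norm_sub_mul_self (𝕜 := ℂ), ho.1, ho.1, ho.2 hij]
      norm_num
    rw [dist_eq_norm]
    nlinarith [norm_nonneg (b i - b j)]
  have hinfw : Infinite w := by
    by_contra hfin
    rw [not_infinite_iff_finite] at hfin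
    have := Fintype.ofFinite w
    exact hinf (b.toOrthonormalBasis.toBasis.finiteDimensional_of_finite)
  obtain ⟨e⟩ := nonempty_equiv_of_countable (α := ℕ) (β := w)
  refine ⟨fun n => b (e n), ho.comp _ e.injective, fun y hy => ?_⟩
  apply b.repr.injective
  ext i
  rw [map_zero, b.repr_apply_apply]
  simpa using hy (e.symm i)

theorem aux_op {E H : Type} [NormedAddCommGroup E] [NormedSpace ℂ E]
    [NormedAddCommGroup H] [NormedSpace ℂ H] [CompleteSpace H]
    (φ : ℕ → (E →L[ℂ] ℂ)) (v : ℕ → H) (hφ : ∀ m, ‖φ m‖ ≤ 1)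
    (hv : ∀ m, ‖v m‖ ≤ (1 / 2 : ℝ) ^ m * 2) :
    ∃ K : E →L[ℂ] H, IsCompactOperator K ∧ ∀ f, HasSum (fun m => φ m f • v m) (K f) := by
  obtain ⟨T, hT⟩ : ∃ T : ℕ → (E →L[ℂ] H), ∀ m, T m = (φ m).smulRight (v m) :=
    ⟨_, fun _ => rfl⟩
  have hTs : Summable T := by
    refine Summable.of_norm_bounded (g := fun m => (1 / 2 : ℝ) ^ m * 2)
      (summable_geometric_two.mul_right 2) fun m => ?_
    rw [hT, ContinuousLinearMap.norm_smulRight_apply]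
    exact (mul_le_of_le_one_left (norm_nonneg _) (hφ m)).trans (hv m)
  obtain ⟨K, hK⟩ := hTs
  refine ⟨K, ?_, fun f => ?_⟩
  swap
  · have h1 := (ContinuousLinearMap.apply ℂ H f).hasSum hK
    simpa only [ContinuousLinearMap.apply_apply, hT, ContinuousLinearMap.smulRight_apply] using h1
  refine isClosed_setOfPred_isCompactOperator.mem_of_tendsto hK
    (Filter.Eventually.of_forall fun s => ?_)
  refine (compactOperator (RingHom.id ℂ) E H).sum_mem fun m _ => ?_
  have h1 : IsCompactOperator (φ m) := isCompactOperator_of_locallyCompactSpace_dom _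
  rw [hT]
  exact h1.clm_comp ((ContinuousLinearMap.id ℂ ℂ).smulRight (v m))

set_option maxHeartbeats 1000000 in
/-- **Lemma (Davidson–Katsoulis, Lemma 5).**
On a separable infinite-dimensional complex Hilbert space `H` there is an injective compact
operator `K = [K_1 K_2 ⋯]` from the Hilbert space direct sum `H^(∞) = ⊕_{i} H` into `H`
such that the range of each component `K_i = K ∘ ι_i` is dense in `H`. -/
theorem exists_compact_injective_row_with_dense_range_components
    (H : Type) [NormedAddCommGroup H] [InnerProductSpace ℂ H] [CompleteSpace H]
    [TopologicalSpace.SeparableSpace H] (hinf : ¬ FiniteDimensional ℂ H) :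
    ∃ K : lp (fun _ : ℕ => H) 2 →L[ℂ] H,
      IsCompactOperator K ∧ Function.Injective K ∧
      ∀ i : ℕ, Dense (Set.range fun h : H => K (lp.single 2 i h)) := by
  obtain ⟨b, ho, htot⟩ := aux_basis H hinf
  let l : ℕ → ℂ := fun m => 1 / ((m : ℂ) + 2)
  have hl0 : ∀ m, l m ≠ 0 := by
    intro m
    refine one_div_ne_zero ?_
    exact_mod_cast (by positivity : ((m : ℝ) + 2) ≠ 0)
  have hlr : ∀ m, l m = ((1 / ((m : ℝ) + 2) : ℝ) : ℂ) := by
    intro m; simp [l]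
  have hln : ∀ m, ‖l m‖ ≤ 1 / 2 := by
    intro m
    rw [hlr, Complex.norm_real, Real.norm_of_nonneg (by positivity)]
    apply one_div_le_one_div_of_le (by norm_num)
    have : (0 : ℝ) ≤ m := by positivity
    linarith
  have hkb : ∀ m n, ‖l m ^ n • b n‖ ≤ (1 / 2 : ℝ) ^ n := by
    intro m n
    rw [norm_smul, ho.1, mul_one, norm_pow]
    exact pow_le_pow_left₀ (norm_nonneg _) (hln m) n
  have hks : ∀ m, Summable fun n => l m ^ n • b n := fun m =>
    Summable.of_norm_bounded summable_geometric_two (hkb m)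
  let k : ℕ → H := fun m => ∑' n, l m ^ n • b n
  have hkn : ∀ m, ‖k m‖ ≤ 2 := by
    intro m
    exact tsum_of_norm_bounded hasSum_geometric_two (hkb m)
  have hyk : ∀ y m, inner ℂ y (k m) = ∑' n, l m ^ n * inner ℂ y (b n) := by
    intro y m
    have := (innerSL ℂ y).map_tsum (hks m)
    simpa [innerSL_apply_apply, inner_smul_right] using this
  have hbk : ∀ n m, inner ℂ (b n) (k m) = l m ^ n := by
    intro n m
    rw [hyk, tsum_eq_single n]
    · simp [inner_self_eq_norm_sq_to_K, ho.1]
    · intro n' hn'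
      rw [ho.2 hn'.symm, mul_zero]
  let E : ℕ → (lp (fun _ : ℕ => H) 2 →L[ℂ] H) := fun i => lp.evalCLM ℂ (fun _ : ℕ => H) 2 i
  have hEn : ∀ i f, E i f = f i := fun i f => rfl
  let φ : ℕ → (lp (fun _ : ℕ => H) 2 →L[ℂ] ℂ) := fun m =>
    (innerSL ℂ (b m.unpair.2)).comp (E m.unpair.1)
  have hφ : ∀ m f, φ m f = inner ℂ (b m.unpair.2) (f m.unpair.1) := fun m f => rfl
  have hφle : ∀ m f, ‖φ m f‖ ≤ ‖f‖ := by
    intro m f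
    rw [hφ]
    refine (norm_inner_le_norm _ _).trans ?_
    rw [ho.1, one_mul]
    exact lp.norm_apply_le_norm (by norm_num) f _
  have hφn : ∀ m, ‖φ m‖ ≤ 1 := fun m =>
    ContinuousLinearMap.opNorm_le_bound _ zero_le_one fun f => by
      rw [one_mul]; exact hφle m f
  obtain ⟨K, hKc, hKapp⟩ := aux_op φ (fun m => (1 / 2 : ℂ) ^ m • k m) hφn (fun m => by
    have : ‖(1 / 2 : ℂ)‖ = 1 / 2 := by norm_num
    rw [norm_smul, norm_pow, this]
    gcongr
    exact hkn m)
  refine ⟨K, hKc, ?_, ?_⟩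
  · rw [injective_iff_map_eq_zero]
    intro f hf
    have hzero : ∀ m, (1 / 2 : ℂ) ^ m * φ m f = 0 := by
      refine aux_inj _ ?_ ?_
      · refine Summable.of_nonneg_of_le (fun _ => norm_nonneg _) (fun m => ?_)
          (summable_geometric_two.mul_right ‖f‖)
        rw [norm_mul, norm_pow]
        have : ‖(1 / 2 : ℂ)‖ = 1 / 2 := by norm_num
        rw [this]
        gcongr
        exact hφle m f
      · intro n
        have h1 := ((innerSL ℂ (b n)).hasSum (hKapp f)).tsum_eq
        rw [hf, map_zero] at h1
        rw [← h1]
        refine tsum_congr fun m => ?_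
        simp only [innerSL_apply_apply, inner_smul_right, hbk, l]
        ring
    ext i
    refine htot _ fun j => ?_
    have := hzero (Nat.pair i j)
    rw [hφ, Nat.unpair_pair] at this
    simpa using this
  · intro i
    let R : H →ₗ[ℂ] H := K.toLinearMap ∘ₗ (lp.lsingle (𝕜 := ℂ) (E := fun _ : ℕ => H) 2 i)
    have hR : (Set.range fun h : H => K (lp.single 2 i h)) = (LinearMap.range R : Set H) := by
      ext; rfl
    rw [hR, Submodule.dense_iff_topologicalClosure_eq_top, Submodule.topologicalClosure_eq_top_iff,
      Submodule.eq_bot_iff]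
    intro y hy
    have hRb : ∀ j, R (b j) = (1 / 2 : ℂ) ^ (Nat.pair i j) • k (Nat.pair i j) := by
      intro j
      refine (hKapp (lp.single 2 i (b j))).unique ?_
      have h1 : φ (Nat.pair i j) (lp.single 2 i (b j)) •
          ((1 / 2 : ℂ) ^ (Nat.pair i j) • k (Nat.pair i j)) = (1 / 2 : ℂ) ^ (Nat.pair i j) • k (Nat.pair i j) := by
        rw [hφ, Nat.unpair_pair]
        simp [inner_self_eq_norm_sq_to_K, ho.1]
      rw [← h1]
      refine hasSum_single _ fun m hm => ?_
      rw [hφ]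
      by_cases hi : m.unpair.1 = i
      · have hj : m.unpair.2 ≠ j := by
          rintro rfl
          exact hm (by rw [← hi, Nat.pair_unpair])
        rw [hi, lp.single_apply_self, ho.2 hj, zero_smul]
      · rw [lp.single_apply_ne _ _ _ hi, inner_zero_right, zero_smul]
    have hyz : ∀ j, inner ℂ y (k (Nat.pair i j)) = 0 := by
      intro j
      have h1 := (Submodule.mem_orthogonal' _ _).1 hy _ (LinearMap.mem_range_self R (b j))
      rw [hRb, inner_smul_right] at h1
      exact (mul_eq_zero.1 h1).resolve_left (pow_ne_zero _ (by norm_num))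
    have hl_tend : Filter.Tendsto l Filter.atTop (nhds 0) := by
      have h1 : Filter.Tendsto (fun m : ℕ => 1 / ((m : ℝ) + 2)) Filter.atTop (nhds 0) := by
        have := (tendsto_one_div_add_atTop_nhds_zero_nat (𝕜 := ℝ)).comp (Filter.tendsto_add_atTop_nat 1)
        refine this.congr fun m => ?_
        simp only [Function.comp]; push_cast; ring_nf
      have h2 := (Complex.continuous_ofReal.tendsto 0).comp h1
      rw [Complex.ofReal_zero] at h2
      exact h2.congr fun m => (hlr m).symm
    have hc := aux_dense (fun n => inner ℂ y (b n)) ‖y‖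
      (fun n => (norm_inner_le_norm _ _).trans (by rw [ho.1, mul_one]))
      (fun j => l (Nat.pair i j)) (fun j => hln _) (fun j => hl0 _)
      (hl_tend.comp (Filter.tendsto_atTop_mono (fun j => Nat.right_le_pair i j) Filter.tendsto_id))
      (fun j => by
        rw [← hyz j, hyk]
        exact tsum_congr fun n => mul_comm _ _)
    refine htot y fun n => ?_
    rw [← inner_conj_symm, hc n, map_zero]
end
end

section
/- Suppose K_1 and K_2 are injective compact operators with dense range on a separable infinite-dimensional complex Hilbert space H. Then there exist invertible operators S_1 and S_2 on H such that the norm-closed algebra generated by K_1S_1 and K_2S_2 is the whole algebra K(H) of compact operators on H. -/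
noncomputable section
open Module.End

theorem aux_diag {H ι : Type} [NormedAddCommGroup H] [InnerProductSpace ℂ H] [CompleteSpace H]
    (b : HilbertBasis ι ℂ H) (d : ι → ℂ) (r : ℝ) (hr : 0 ≤ r) (hd : ∀ i, ‖d i‖ ≤ r) :
    ∃ D : H →L[ℂ] H, (∀ i, D (b i) = d i • b i) ∧ ‖D‖ ≤ r := by
  classical
  have h2 : (0:ℝ) < (2 : ENNReal).toReal := by norm_num
  have key : ∀ (f : lp (fun _ : ι => ℂ) 2) (i : ι),
      ‖d i * f i‖ ^ (2 : ENNReal).toReal ≤ r ^ (2 : ENNReal).toReal * ‖f i‖ ^ (2 : ENNReal).toReal := by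
    intro f i
    rw [← Real.mul_rpow hr (norm_nonneg _), norm_mul]
    gcongr
    exact hd i
  have hs : ∀ f : lp (fun _ : ι => ℂ) 2, Summable fun i => ‖d i * f i‖ ^ (2 : ENNReal).toReal := by
    intro f
    exact Summable.of_nonneg_of_le (fun i => by positivity) (key f)
      (((lp.memℓp f).summable h2).mul_left _)
  let L : lp (fun _ : ι => ℂ) 2 →ₗ[ℂ] lp (fun _ : ι => ℂ) 2 :=
    { toFun := fun f => ⟨fun i => d i * f i, memℓp_gen (hs f)⟩
      map_add' := by
        intro f g; ext i; simp [mul_add]; rfl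
      map_smul' := by
        intro c f; ext i; simp; ring }
  have hL : ∀ f i, L f i = d i * f i := fun f i => rfl
  have hLn : ∀ f, ‖L f‖ ≤ r * ‖f‖ := by
    intro f
    apply lp.norm_le_of_tsum_le h2 (by positivity)
    rw [Real.mul_rpow hr (norm_nonneg _), lp.norm_rpow_eq_tsum h2 f, ← tsum_mul_left]
    exact Summable.tsum_le_tsum (key f) (hs f) (((lp.memℓp f).summable h2).mul_left _)
  let D : H →L[ℂ] H := (b.repr.symm.toContinuousLinearEquiv : lp (fun _ : ι => ℂ) 2 →L[ℂ] H) ∘L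
    (L.mkContinuous r hLn) ∘L (b.repr.toContinuousLinearEquiv : H →L[ℂ] lp (fun _ : ι => ℂ) 2)
  have hD : ∀ x, D x = b.repr.symm (L (b.repr x)) := fun x => rfl
  refine ⟨D, ?_, ?_⟩
  · intro i
    rw [hD, ← b.repr.symm_apply_apply (d i • b i)]
    congr 1
    ext j
    rw [hL, map_smul, b.repr_self]
    simp only [lp.coeFn_smul, Pi.smul_apply, lp.single_apply, smul_eq_mul]
    by_cases h : j = i
    · subst h; simp
    · simp [h]
  · refine D.opNorm_le_bound hr fun x => ?_
    rw [hD, LinearIsometryEquiv.norm_map]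
    simpa using hLn (b.repr x)

theorem aux_ext {H ι : Type} [NormedAddCommGroup H] [InnerProductSpace ℂ H] [CompleteSpace H]
    (b : HilbertBasis ι ℂ H) {A B : H →L[ℂ] H} (h : ∀ i, A (b i) = B (b i)) : A = B := by
  refine ContinuousLinearMap.ext_on (s := Set.range b) ?_ ?_
  · rw [Submodule.dense_iff_topologicalClosure_eq_top]; exact b.dense_span
  · rintro _ ⟨i, rfl⟩; exact h i

theorem aux_norm {H ι : Type} [NormedAddCommGroup H] [InnerProductSpace ℂ H] [CompleteSpace H]
    (b : HilbertBasis ι ℂ H) (d : ι → ℂ) (r : ℝ) (hr : 0 ≤ r) (hd : ∀ i, ‖d i‖ ≤ r)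
    (D : H →L[ℂ] H) (hD : ∀ i, D (b i) = d i • b i) : ‖D‖ ≤ r := by
  obtain ⟨D', h1, h2⟩ := aux_diag b d r hr hd
  rwa [aux_ext b (A := D) (B := D') (fun i => by rw [hD, h1])]

theorem aux_svd {H : Type} [NormedAddCommGroup H] [InnerProductSpace ℂ H] [CompleteSpace H]
    (K : H →L[ℂ] H) (hc : IsCompactOperator K) (hi : Function.Injective K)
    (hd : Dense (Set.range K)) :
    ∃ (ι : Type) (e f : HilbertBasis ι ℂ H) (s : ι → ℝ), (∀ i, 0 < s i) ∧
      (∀ i, K (e i) = (s i : ℂ) • f i) ∧ ∀ ε > 0, {i | ε ≤ s i}.Finite := by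
  classical
  set T : H →L[ℂ] H := (ContinuousLinearMap.adjoint K) ∘L K with hT
  have hTc : IsCompactOperator T := hc.clm_comp (ContinuousLinearMap.adjoint K)
  have hTs : T.IsSymmetric := by
    intro x y
    simp [hT, ContinuousLinearMap.adjoint_inner_left, ContinuousLinearMap.adjoint_inner_right]
  have hbot := ContinuousLinearMap.orthogonalComplement_iSup_eigenspaces_eq_bot hTc hTs
  have hof := hTs.orthogonalFamily_eigenspaces
  have hclosed : ∀ μ, IsClosed ((eigenspace (T : Module.End ℂ H) μ : Submodule ℂ H) : Set H) := by
    intro μ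
    have : ((eigenspace (T : Module.End ℂ H) μ : Submodule ℂ H) : Set H) = {x | T x = μ • x} := by
      ext x; simp
    rw [this]
    exact isClosed_eq T.continuous (continuous_const_smul μ)
  have : ∀ μ, CompleteSpace (eigenspace (T : Module.End ℂ H) μ) := fun μ =>
    (hclosed μ).completeSpace_coe
  choose w b hb using fun μ => exists_hilbertBasis ℂ (eigenspace (T : Module.End ℂ H) μ)
  have hon := hof.orthonormal_sigma_orthonormal (fun μ => (b μ).orthonormal)
  set v : (Σ μ, w μ) → H := fun a => ((b a.1 a.2 : eigenspace (T : Module.End ℂ H) a.1) : H) with hv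
  have hon' : Orthonormal ℂ v := hon
  have hsp : (Submodule.span ℂ (Set.range v))ᗮ = ⊥ := by
    rw [eq_bot_iff, ← hbot]
    intro x hx
    rw [← Submodule.iInf_orthogonal, Submodule.mem_iInf]
    intro μ
    rw [Submodule.mem_orthogonal']
    have hz : (innerSL ℂ x) ∘L (eigenspace (T : Module.End ℂ H) μ).subtypeL = 0 := by
      refine ContinuousLinearMap.ext_on (s := Set.range (b μ)) ?_ ?_
      · rw [Submodule.dense_iff_topologicalClosure_eq_top]; exact (b μ).dense_span
      · rintro _ ⟨i, rfl⟩
        have := (Submodule.mem_orthogonal' _ _).1 hx (v ⟨μ, i⟩) (Submodule.subset_span ⟨_, rfl⟩)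
        simpa [hv] using this
    intro u hu
    have := congrArg (fun g => g ⟨u, hu⟩) hz
    simpa using this
  let e : HilbertBasis (Σ μ, w μ) ℂ H := HilbertBasis.mkOfOrthogonalEqBot hon' hsp
  have he : ∀ a, e a = v a := fun a => by
    simp [e]
  have heig : ∀ a, T (v a) = a.1 • v a := fun a => by
    have := (b a.1 a.2).2
    rwa [mem_eigenspace_iff] at this
  set s : (Σ μ, w μ) → ℝ := fun a => ‖K (v a)‖ with hs
  have hspos : ∀ a, 0 < s a := fun a => by
    rw [hs]; simp only [norm_pos_iff]
    intro h
    have : v a = 0 := hi (by simpa using h)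
    exact hon'.ne_zero a this
  have hsne : ∀ a, ((s a : ℝ) : ℂ) ≠ 0 := fun a => by exact_mod_cast (hspos a).ne'
  set g : (Σ μ, w μ) → H := fun a => ((s a : ℂ)⁻¹) • K (v a) with hg
  have hKv : ∀ a, K (v a) = (s a : ℂ) • g a := fun a => by
    simp only [hg]; rw [smul_smul, mul_inv_cancel₀ (hsne a), one_smul]
  have hgon : Orthonormal ℂ g := by
    constructor
    · intro a
      simp only [hg, norm_smul, norm_inv, Complex.norm_real, Real.norm_eq_abs, abs_of_pos (hspos a)]
      exact inv_mul_cancel₀ (hspos a).ne'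
    · intro a a' h
      have h0 : inner ℂ (K (v a)) (K (v a')) = 0 := by
        rw [← ContinuousLinearMap.adjoint_inner_left]
        change inner ℂ (T (v a)) (v a') = 0
        rw [heig, inner_smul_left, hon'.2 h, mul_zero]
      simp only [hg, inner_smul_left, inner_smul_right, h0, mul_zero]
  have hgsp : (Submodule.span ℂ (Set.range g))ᗮ = ⊥ := by
    rw [eq_bot_iff]
    intro x hx
    have h1 : ∀ a, inner ℂ x (K (v a)) = 0 := fun a => by
      rw [hKv, inner_smul_right,
        (Submodule.mem_orthogonal' _ _).1 hx (g a) (Submodule.subset_span ⟨_, rfl⟩), mul_zero]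
    have h2 : (innerSL ℂ x) ∘L K = 0 := by
      refine ContinuousLinearMap.ext_on (s := Set.range e) ?_ ?_
      · rw [Submodule.dense_iff_topologicalClosure_eq_top]; exact e.dense_span
      · rintro _ ⟨i, rfl⟩
        simpa [he] using h1 i
    have h3 : innerSL ℂ x = 0 := by
      apply ContinuousLinearMap.coeFn_injective
      refine Continuous.ext_on hd (innerSL ℂ x).continuous continuous_const ?_
      rintro _ ⟨y, rfl⟩
      simpa using congrArg (fun g => g y) h2
    have h4 := congrArg (fun g => g x) h3
    simpa using h4
  let f : HilbertBasis (Σ μ, w μ) ℂ H := HilbertBasis.mkOfOrthogonalEqBot hgon hgsp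
  have hf : ∀ a, f a = g a := fun a => by simp [f]
  refine ⟨_, e, f, s, hspos, fun a => by rw [he, hf, hKv], ?_⟩
  intro ε hε
  have hcomp := hc.isCompact_closure_image_closedBall (f := (K : H →ₗ[ℂ] H)) 1
  obtain ⟨t, -, htf, hcov⟩ := hcomp.finite_cover_balls (e := ε / 2) (by positivity)
  have hmem : ∀ a, ∃ c ∈ t, dist (K (v a)) c < ε / 2 := fun a => by
    have : K (v a) ∈ closure ((K : H →ₗ[ℂ] H) '' Metric.closedBall 0 1) :=
      subset_closure ⟨v a, by simp [hon'.1 a], rfl⟩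
    simpa using hcov this
  choose c hct hcd using hmem
  refine Set.Finite.of_finite_image (f := c) (htf.subset ?_) ?_
  · rintro _ ⟨a, -, rfl⟩; exact hct a
  · intro a ha a' ha' hcc
    by_contra hne
    have hlt : dist (K (v a)) (K (v a')) < ε := by
      have := dist_triangle_right (K (v a)) (K (v a')) (c a)
      have h1 := hcd a
      have h2 := hcd a'
      rw [← hcc] at h2
      linarith
    have h0 : inner ℂ (K (v a)) (K (v a')) = 0 := by
      rw [hKv, hKv, inner_smul_left, inner_smul_right, hgon.2 hne]; simp
    have h3 : ‖K (v a) - K (v a')‖ * ‖K (v a) - K (v a')‖ = s a * s a + s a' * s a' := by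
      rw [@norm_sub_mul_self ℂ, h0]; simp [hs]
    rw [dist_eq_norm] at hlt
    have h4 : ε ≤ s a := ha
    have := hspos a'
    nlinarith [norm_nonneg (K (v a) - K (v a'))]

theorem aux_proj {H ι : Type} [NormedAddCommGroup H] [InnerProductSpace ℂ H] [CompleteSpace H]
    (M : NonUnitalSubalgebra ℂ (H →L[ℂ] H)) (hM : IsClosed (M : Set (H →L[ℂ] H)))
    (f : HilbertBasis ι ℂ H) (β : ι → ℝ) (hpos : ∀ i, 0 < β i) (hinj : Function.Injective β)
    (hfin : ∀ ε > 0, {i | ε ≤ β i}.Finite) (B : H →L[ℂ] H) (hBM : B ∈ M)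
    (hB : ∀ i, B (f i) = (β i : ℂ) • f i) (i : ι) :
    InnerProductSpace.rankOne ℂ (f i) (f i) ∈ M := by
  classical
  let F : ι → Finset ι := fun i => (hfin (β i) (hpos i)).toFinset
  have hF : ∀ i j, j ∈ F i ↔ β i ≤ β j := fun i j => by simp [F]
  have hff : ∀ i j, inner ℂ (f i) (f j) = if i = j then (1:ℂ) else 0 :=
    orthonormal_iff_ite.1 f.orthonormal
  induction i using (measure (fun i => (F i).card)).wf.induction with
  | _ i ih =>
  have ih' : ∀ j ∈ (F i).erase i, InnerProductSpace.rankOne ℂ (f j) (f j) ∈ M := by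
    intro j hj
    rw [Finset.mem_erase, hF] at hj
    have hlt : β i < β j := lt_of_le_of_ne hj.2 fun h => hj.1 (hinj h).symm
    apply ih
    apply Finset.card_lt_card
    rw [Finset.ssubset_iff_of_subset]
    · exact ⟨i, by simp [hF], by simp [hF, hlt]⟩
    · intro k hk
      rw [hF] at hk ⊢
      linarith
  set E := InnerProductSpace.rankOne ℂ (f i) (f i) with hE
  set C : H →L[ℂ] H := B - ∑ j ∈ (F i).erase i, (β j : ℂ) • InnerProductSpace.rankOne ℂ (f j) (f j)
    with hC
  have hCM : C ∈ M := sub_mem hBM (sum_mem fun j hj => SMulMemClass.smul_mem _ (ih' j hj))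
  set X : H →L[ℂ] H := ((β i : ℂ)⁻¹) • C with hX
  have hXM : X ∈ M := SMulMemClass.smul_mem _ hCM
  have hβ : (β i : ℂ) ≠ 0 := by exact_mod_cast (hpos i).ne'
  set D := X - E with hD
  let d : ι → ℂ := fun m => if β i ≤ β m then 0 else ((β m / β i : ℝ) : ℂ)
  have hsum : ∀ m, (∑ j ∈ (F i).erase i, (β j : ℂ) • InnerProductSpace.rankOne ℂ (f j) (f j)) (f m)
      = if m ∈ (F i).erase i then (β m : ℂ) • f m else 0 := by
    intro m
    rw [ContinuousLinearMap.sum_apply]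
    simp only [ContinuousLinearMap.smul_apply, InnerProductSpace.rankOne_apply, hff, ite_smul,
      one_smul, zero_smul, smul_ite, smul_zero]
    rw [Finset.sum_ite_eq']
  have hDf : ∀ m, D (f m) = d m • f m := by
    intro m
    simp only [hD, hX, hC, ContinuousLinearMap.sub_apply, ContinuousLinearMap.smul_apply, hsum, hB,
      hE, InnerProductSpace.rankOne_apply, hff, d, Finset.mem_erase, hF]
    by_cases h : i = m
    · subst h; simp [hβ, smul_smul, -Complex.coe_smul]
    · have h' : m ≠ i := fun hh => h hh.symm
      by_cases h2 : β i ≤ β m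
      · simp [h, h', h2]
      · simp only [h, h2, if_false, and_false, sub_zero, zero_smul, smul_smul]
        congr 1
        push_cast
        field_simp
  have hdi : d i = 0 := by simp [d]
  obtain ⟨r, hr0, hr1, hr⟩ : ∃ r : ℝ, 0 ≤ r ∧ r < 1 ∧ ∀ m, ‖d m‖ ≤ r := by
    have hGf : {m | β i / 2 ≤ β m ∧ β m < β i}.Finite :=
      (hfin (β i / 2) (half_pos (hpos i))).subset fun m hm => hm.1
    have hnorm : ∀ m, β m < β i → ‖d m‖ = β m / β i := fun m hm => by
      simp only [d, not_le.2 hm, if_false, Complex.norm_real, Real.norm_eq_abs]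
      exact abs_of_pos (div_pos (hpos m) (hpos i))
    have hnorm0 : ∀ m, β i ≤ β m → ‖d m‖ = 0 := fun m hm => by simp [d, hm]
    rcases Set.eq_empty_or_nonempty {m | β i / 2 ≤ β m ∧ β m < β i} with h | h
    · refine ⟨1/2, by norm_num, by norm_num, fun m => ?_⟩
      rcases le_or_gt (β i) (β m) with hm | hm
      · rw [hnorm0 m hm]; norm_num
      · rw [hnorm m hm, div_le_iff₀ (hpos i)]
        by_contra hcon
        have : m ∈ {m | β i / 2 ≤ β m ∧ β m < β i} := ⟨by linarith, hm⟩
        rw [h] at this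
        exact this
    · obtain ⟨m0, hm0, hmax⟩ := Set.exists_max_image _ β hGf h
      refine ⟨β m0 / β i, (div_pos (hpos _) (hpos _)).le, (div_lt_one (hpos i)).2 hm0.2,
        fun m => ?_⟩
      rcases le_or_gt (β i) (β m) with hm | hm
      · rw [hnorm0 m hm]; exact (div_pos (hpos _) (hpos _)).le
      · rw [hnorm m hm, div_le_div_iff_of_pos_right (hpos i)]
        rcases le_or_gt (β i / 2) (β m) with h2 | h2
        · exact hmax m ⟨h2, hm⟩
        · exact h2.le.trans hm0.1
  have hDn : ‖D‖ < 1 := (aux_norm f d r hr0 hr D hDf).trans_lt hr1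
  have hEf : ∀ m, E (f m) = if i = m then f i else 0 := fun m => by
    simp only [hE, InnerProductSpace.rankOne_apply, hff, ite_smul, one_smul, zero_smul]
  have hDE : D * E = 0 := aux_ext f fun m => by
    rw [mul_apply_eq_comp, hEf]
    split_ifs <;> simp [hDf, hdi]
  have hED : E * D = 0 := aux_ext f fun m => by
    rw [mul_apply_eq_comp, hDf, map_smul, hEf]
    split_ifs with h
    · subst h; simp [hdi]
    · simp
  have hEE : E * E = E := InnerProductSpace.isIdempotentElem_rankOne_self (f.orthonormal.1 i)
  have hXD : X = D + E := by simp [hD]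
  have hpow : ∀ k : ℕ, X ^ (k+1) = D ^ (k+1) + E := by
    intro k
    induction k with
    | zero => simp [hXD]
    | succ k ihk =>
      rw [pow_succ, ihk, hXD, add_mul, mul_add, mul_add, hEE, hED, pow_succ D k, mul_assoc _ D E,
        hDE, pow_succ D (k+1), pow_succ D k]
      simp
  have hpM : ∀ k : ℕ, X ^ (k+1) ∈ M := by
    intro k
    induction k with
    | zero => simpa using hXM
    | succ k ihk => rw [pow_succ]; exact mul_mem ihk hXM
  have hlim : Filter.Tendsto (fun k : ℕ => X ^ (k+1)) Filter.atTop (nhds E) := by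
    have h1 := (tendsto_pow_atTop_nhds_zero_of_norm_lt_one hDn).comp (Filter.tendsto_add_atTop_nat 1)
    have h2 := h1.add_const E
    rw [zero_add] at h2
    refine h2.congr fun k => ?_
    simp [hpow]
  exact hM.mem_of_tendsto hlim (Filter.Eventually.of_forall hpM)

theorem aux_all {H ι : Type} [NormedAddCommGroup H] [InnerProductSpace ℂ H] [CompleteSpace H]
    (M : NonUnitalSubalgebra ℂ (H →L[ℂ] H)) (hM : IsClosed (M : Set (H →L[ℂ] H)))
    (f : HilbertBasis ι ℂ H) (hf : ∀ i, InnerProductSpace.rankOne ℂ (f i) (f i) ∈ M)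
    (A : H →L[ℂ] H) (hA : A ∈ M) (hne : ∀ i j, inner ℂ (f i) (A (f j)) ≠ 0)
    (T : H →L[ℂ] H) (hT : IsCompactOperator T) : T ∈ M := by
  classical
  have h1 : ∀ i j, InnerProductSpace.rankOne ℂ (f i) (f j) ∈ M := by
    intro i j
    have h := SMulMemClass.smul_mem (inner ℂ (f i) (A (f j)))⁻¹ (mul_mem (mul_mem (hf i) hA) (hf j))
    convert h using 1
    ext x
    simp only [ContinuousLinearMap.smul_apply, mul_apply_eq_comp,
      InnerProductSpace.rankOne_apply, map_smul, inner_smul_right, smul_smul]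
    congr 1
    field_simp [hne i j]
  have hdense : Dense ((Submodule.span ℂ (Set.range f) : Submodule ℂ H) : Set H) := by
    rw [Submodule.dense_iff_topologicalClosure_eq_top]; exact f.dense_span
  have h2 : ∀ u j, InnerProductSpace.rankOne ℂ u (f j) ∈ M := by
    intro u j
    have hcl : IsClosed {u : H | InnerProductSpace.rankOne ℂ u (f j) ∈ M} :=
      hM.preimage (f := fun u : H => InnerProductSpace.rankOne ℂ u (f j)) (by fun_prop)
    refine hcl.closure_subset_iff.2 ?_ (hdense u)
    intro x hx
    induction hx using Submodule.span_induction with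
    | mem x hx => obtain ⟨i, rfl⟩ := hx; exact h1 i j
    | zero => simp
    | add x y _ _ hx hy =>
      have := add_mem (S := NonUnitalSubalgebra ℂ (H →L[ℂ] H)) (s := M) (show InnerProductSpace.rankOne ℂ x (f j) ∈ M from hx) (show InnerProductSpace.rankOne ℂ y (f j) ∈ M from hy)
      simpa using this
    | smul a x _ hx =>
      have := SMulMemClass.smul_mem a (show InnerProductSpace.rankOne ℂ x (f j) ∈ M from hx)
      simpa using this
  have h3 : ∀ u v, InnerProductSpace.rankOne ℂ u v ∈ M := by
    intro u v
    have hcl : IsClosed {v : H | InnerProductSpace.rankOne ℂ u v ∈ M} :=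
      hM.preimage (InnerProductSpace.rankOne ℂ u).continuous
    refine hcl.closure_subset_iff.2 ?_ (hdense v)
    intro x hx
    induction hx using Submodule.span_induction with
    | mem x hx => obtain ⟨i, rfl⟩ := hx; exact h2 u i
    | zero => simp
    | add x y _ _ hx hy =>
      have := add_mem (S := NonUnitalSubalgebra ℂ (H →L[ℂ] H)) (s := M) (show InnerProductSpace.rankOne ℂ u x ∈ M from hx) (show InnerProductSpace.rankOne ℂ u y ∈ M from hy)
      simpa using this
    | smul a x _ hx =>
      have := SMulMemClass.smul_mem (starRingEnd ℂ a) (show InnerProductSpace.rankOne ℂ u x ∈ M from hx)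
      simpa using this
  have hmem : T ∈ closure (M : Set (H →L[ℂ] H)) := by
    rw [Metric.mem_closure_iff]
    intro ε hε
    have hcomp := hT.isCompact_closure_image_closedBall (f := (T : H →ₗ[ℂ] H)) 1
    obtain ⟨t, -, htf, hcov⟩ := hcomp.finite_cover_balls (e := ε / 2) (by positivity)
    let V : Submodule ℂ H := Submodule.span ℂ t
    have : FiniteDimensional ℂ V := FiniteDimensional.span_of_finite ℂ htf
    let P : H →L[ℂ] H := V.starProjection
    refine ⟨P * T, ?_, ?_⟩
    · have hP : P = _ := (stdOrthonormalBasis ℂ V).starProjection_eq_sum_rankOne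
      rw [hP, Finset.sum_mul]
      refine sum_mem fun j _ => ?_
      have : InnerProductSpace.rankOne ℂ (stdOrthonormalBasis ℂ V j : H)
          (stdOrthonormalBasis ℂ V j : H) * T = InnerProductSpace.rankOne ℂ
          (stdOrthonormalBasis ℂ V j : H)
          (ContinuousLinearMap.adjoint T (stdOrthonormalBasis ℂ V j : H)) :=
        InnerProductSpace.rankOne_comp _ _ _
      rw [this]
      exact h3 _ _
    · rw [dist_eq_norm]
      refine lt_of_le_of_lt ?_ (half_lt_self hε)
      refine ContinuousLinearMap.opNorm_le_of_unit_norm (by positivity) ?_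
      intro x hx
      have : T x ∈ closure ((T : H →ₗ[ℂ] H) '' Metric.closedBall 0 1) :=
        subset_closure ⟨x, by simp [hx], rfl⟩
      obtain ⟨c, hct, hc⟩ : ∃ c ∈ t, dist (T x) c < ε / 2 := by simpa using hcov this
      have hmin : ‖T x - V.starProjection (T x)‖ ≤ ‖T x - c‖ := by
        rw [Submodule.starProjection_minimal]
        exact ciInf_le ⟨0, by rintro _ ⟨y, rfl⟩; positivity⟩
          (⟨c, Submodule.subset_span hct⟩ : V)
      rw [dist_eq_norm] at hc
      exact hmin.trans hc.le
  rwa [hM.closure_eq] at hmem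

theorem aux_baire {H ι : Type} [NormedAddCommGroup H] [InnerProductSpace ℂ H] [CompleteSpace H]
    [Countable ι] (f : HilbertBasis ι ℂ H) (K : H →L[ℂ] H) (hd : Dense (Set.range K)) :
    ∃ S : H →L[ℂ] H, IsUnit S ∧ ∀ i j, inner ℂ (f i) ((K * S) (f j)) ≠ 0 := by
  let φ : ι × ι → (H →L[ℂ] H) →L[ℂ] ℂ := fun p =>
    (innerSL ℂ (f p.1)) ∘L K ∘L (ContinuousLinearMap.apply ℂ H (f p.2))
  have hφ : ∀ p S, φ p S = inner ℂ (f p.1) ((K * S) (f p.2)) := fun p S => rfl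
  have hφne : ∀ p, ∃ S, φ p S ≠ 0 := by
    intro p
    by_contra! hcon
    have h3 : innerSL ℂ (f p.1) = 0 := by
      apply ContinuousLinearMap.coeFn_injective
      refine Continuous.ext_on hd (innerSL ℂ (f p.1)).continuous continuous_const ?_
      rintro _ ⟨y, rfl⟩
      have := hcon (InnerProductSpace.rankOne ℂ y (f p.2))
      rw [hφ] at this
      simpa [f.orthonormal.1] using this
    have h4 := congrArg (fun g => g (f p.1)) h3
    simp [f.orthonormal.1] at h4
  have hdense : Dense (⋂ p, {S | φ p S ≠ 0}) := by
    refine dense_iInter_of_isOpen (fun p => isOpen_ne_fun (φ p).continuous continuous_const) ?_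
    intro p
    change Dense ({S | φ p S = 0}ᶜ)
    rw [← interior_eq_empty_iff_dense_compl, ← Set.not_nonempty_iff_eq_empty]
    intro hne
    have := Submodule.eq_top_of_nonempty_interior' (LinearMap.ker (φ p : (H →L[ℂ] H) →ₗ[ℂ] ℂ)) hne
    obtain ⟨S, hS⟩ := hφne p
    exact hS (by
      have h : S ∈ LinearMap.ker (φ p : (H →L[ℂ] H) →ₗ[ℂ] ℂ) := by rw [this]; trivial
      simpa using h)
  obtain ⟨S, hS1, hS2⟩ := hdense.inter_open_nonempty _ (Units.isOpen (R := H →L[ℂ] H)) ⟨1, isUnit_one⟩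
  refine ⟨S, hS1, fun i j => ?_⟩
  exact Set.mem_iInter.1 hS2 (i, j)

theorem aux_theta {ι : Type} [Countable ι] (s : ι → ℝ) (hs : ∀ i, 0 < s i) :
    ∃ t : ι → ℝ, (∀ i, 1 ≤ t i ∧ t i ≤ Real.exp 1) ∧ Function.Injective fun i => t i * s i := by
  obtain ⟨n, hn⟩ := exists_injective_nat ι
  let c : ι → ℝ := fun i => 1 / ((n i : ℝ) + 1)
  have hc : ∀ i, 0 < c i ∧ c i ≤ 1 := fun i => by
    constructor
    · positivity
    · simp only [c]; rw [div_le_one (by positivity)]; simp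
  have hci : Function.Injective c := by
    intro i j h
    apply hn
    simp only [c] at h
    field_simp at h
    exact_mod_cast (add_right_cancel h).symm
  let bad : Set ℝ := Set.range fun p : ι × ι =>
    (Real.log (s p.2) - Real.log (s p.1)) / (c p.1 - c p.2)
  have hbad : bad.Countable := Set.countable_range _
  obtain ⟨θ, hθ, hθb⟩ : (Set.Icc (0:ℝ) 1 \ bad).Nonempty := by
    by_contra hcon
    rw [Set.not_nonempty_iff_eq_empty, Set.sdiff_eq_empty] at hcon
    have hc := Cardinal.le_aleph0_iff_set_countable.2 (hbad.mono hcon)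
    rw [Cardinal.mk_Icc_real zero_lt_one] at hc
    exact absurd hc (not_le.2 Cardinal.aleph0_lt_continuum)
  refine ⟨fun i => Real.exp (θ * c i), fun i => ⟨?_, ?_⟩, ?_⟩
  · exact Real.one_le_exp (mul_nonneg hθ.1 (hc i).1.le)
  · apply Real.exp_le_exp.2
    exact mul_le_one₀ hθ.2 (hc i).1.le (hc i).2
  · intro i j h
    by_contra hne
    have hcne : c i - c j ≠ 0 := sub_ne_zero.2 fun h => hne (hci h)
    have h' := congrArg Real.log h
    simp only at h'
    rw [Real.log_mul (Real.exp_ne_zero _) (hs i).ne', Real.log_mul (Real.exp_ne_zero _) (hs j).ne',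
      Real.log_exp, Real.log_exp] at h'
    apply hθb
    refine ⟨(i, j), ?_⟩
    simp only
    rw [div_eq_iff hcne]
    linarith

theorem aux_unit {H ι : Type} [NormedAddCommGroup H] [InnerProductSpace ℂ H] [CompleteSpace H]
    (e f : HilbertBasis ι ℂ H) (t : ι → ℝ) (ht : ∀ i, 1 ≤ t i ∧ t i ≤ Real.exp 1) :
    ∃ S : H →L[ℂ] H, IsUnit S ∧ ∀ i, S (f i) = (t i : ℂ) • e i := by
  classical
  have htne : ∀ i, (t i : ℂ) ≠ 0 := fun i => by
    have := (ht i).1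
    exact_mod_cast (by linarith : 0 < t i).ne'
  obtain ⟨D, hD, -⟩ := aux_diag f (fun i => (t i : ℂ)) (Real.exp 1) (by positivity) (fun i => by
    rw [Complex.norm_real, Real.norm_eq_abs, abs_of_nonneg (by linarith [(ht i).1])]
    exact (ht i).2)
  obtain ⟨D', hD', -⟩ := aux_diag f (fun i => (t i : ℂ)⁻¹) 1 (by positivity) (fun i => by
    rw [norm_inv, Complex.norm_real, Real.norm_eq_abs, abs_of_nonneg (by linarith [(ht i).1])]
    exact inv_le_one_of_one_le₀ (ht i).1)
  let U : H ≃ₗᵢ[ℂ] H := f.repr.trans e.repr.symm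
  have hU : ∀ i, U (f i) = e i := fun i => by
    simp only [U, LinearIsometryEquiv.trans_apply, f.repr_self]
    rw [← e.repr_self, LinearIsometryEquiv.symm_apply_apply]
  have hUu : IsUnit (U.toContinuousLinearEquiv : H →L[ℂ] H) :=
    ⟨ContinuousLinearEquiv.toUnit U.toContinuousLinearEquiv, rfl⟩
  have hDu : IsUnit D := by
    refine isUnit_iff_exists.2 ⟨D', ?_, ?_⟩
    · exact aux_ext f fun i => by
        rw [mul_apply_eq_comp, hD', map_smul, hD, smul_smul, inv_mul_cancel₀ (htne i), one_smul]; rfl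
    · exact aux_ext f fun i => by
        rw [mul_apply_eq_comp, hD, map_smul, hD', smul_smul, mul_inv_cancel₀ (htne i), one_smul]; rfl
  refine ⟨(U.toContinuousLinearEquiv : H →L[ℂ] H) * D, hUu.mul hDu, fun i => ?_⟩
  rw [mul_apply_eq_comp, hD, map_smul]
  congr 1
  exact hU i

/-- **Lemma (Davidson–Katsoulis, Lemma 6).**
If `K₁` and `K₂` are injective compact operators with dense range on a separable
infinite-dimensional complex Hilbert space `H`, then there are invertible operators
`S₁, S₂ ∈ B(H)` such that the norm-closed (non-unital) algebra generated by `K₁S₁` and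
`K₂S₂` is the whole algebra of compact operators on `H`. -/
theorem compact_operators_generated_by_modified_pair
    (H : Type) [NormedAddCommGroup H] [InnerProductSpace ℂ H] [CompleteSpace H]
    [TopologicalSpace.SeparableSpace H] (hinf : ¬ FiniteDimensional ℂ H)
    (K₁ K₂ : H →L[ℂ] H)
    (h₁c : IsCompactOperator K₁) (h₂c : IsCompactOperator K₂)
    (h₁i : Function.Injective K₁) (h₂i : Function.Injective K₂)
    (h₁d : Dense (Set.range K₁)) (h₂d : Dense (Set.range K₂)) :
    ∃ S₁ S₂ : H →L[ℂ] H, IsUnit S₁ ∧ IsUnit S₂ ∧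
      closure ((NonUnitalAlgebra.adjoin ℂ
          ({K₁ * S₁, K₂ * S₂} : Set (H →L[ℂ] H)) : NonUnitalSubalgebra ℂ (H →L[ℂ] H)) :
            Set (H →L[ℂ] H))
        = {T : H →L[ℂ] H | IsCompactOperator T} := by
  obtain ⟨ι, e, f, s, hs, hK, hfin⟩ := aux_svd K₂ h₂c h₂i h₂d
  have hcount : Countable ι := by
    have hU : (Set.univ : Set ι) = ⋃ n : ℕ, {i | 1 / ((n : ℝ) + 1) ≤ s i} := by
      ext i
      simp only [Set.mem_univ, Set.mem_iUnion, true_iff]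
      obtain ⟨n, hn⟩ := exists_nat_one_div_lt (hs i)
      exact ⟨n, hn.le⟩
    rw [← Set.countable_univ_iff, hU]
    exact Set.countable_iUnion fun n => (hfin _ (by positivity)).countable
  obtain ⟨t, ht, htinj⟩ := aux_theta s hs
  obtain ⟨S₂, hS₂, hS₂f⟩ := aux_unit e f t ht
  obtain ⟨S₁, hS₁, hS₁f⟩ := aux_baire f K₁ h₁d
  refine ⟨S₁, S₂, hS₁, hS₂, Set.Subset.antisymm ?_ ?_⟩
  · have hcl : IsClosed {T : H →L[ℂ] H | IsCompactOperator T} :=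
      isClosed_setOfPred_isCompactOperator
    refine closure_minimal ?_ hcl
    intro T hT
    induction hT using NonUnitalAlgebra.adjoin_induction with
    | mem x hx =>
      rcases hx with rfl | rfl
      · exact h₁c.comp_clm S₁
      · exact h₂c.comp_clm S₂
    | add x y _ _ hx hy => exact IsCompactOperator.add hx hy
    | zero => exact isCompactOperator_zero
    | mul x y _ _ hx hy => exact IsCompactOperator.comp_clm hx y
    | smul r x _ hx => exact IsCompactOperator.smul hx r
  · intro T hT
    set N := NonUnitalAlgebra.adjoin ℂ ({K₁ * S₁, K₂ * S₂} : Set (H →L[ℂ] H)) with hN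
    have hsub : ∀ x ∈ ({K₁ * S₁, K₂ * S₂} : Set (H →L[ℂ] H)), x ∈ N.topologicalClosure := fun x hx =>
      N.le_topologicalClosure (NonUnitalAlgebra.subset_adjoin ℂ hx)
    have hclosed := N.isClosed_topologicalClosure
    have hproj := aux_proj N.topologicalClosure hclosed f (fun i => t i * s i)
      (fun i => mul_pos (by linarith [(ht i).1]) (hs i)) htinj
      (fun ε hε => (hfin (ε / Real.exp 1) (by positivity)).subset fun i hi => by
        have h1 : ε ≤ t i * s i := hi
        change ε / Real.exp 1 ≤ s i
        rw [div_le_iff₀ (Real.exp_pos 1)]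
        nlinarith [(ht i).2, hs i])
      (K₂ * S₂) (hsub _ (by simp))
      (fun i => by
        rw [mul_apply_eq_comp, hS₂f, map_smul, hK, smul_smul]
        push_cast; rfl)
    exact aux_all N.topologicalClosure hclosed f hproj (K₁ * S₁) (hsub _ (by simp)) hS₁f T hT
end
end
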